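/- Under the bounds V, V₀, V', V₀' comparable (m ≤ each ≤ M with 0 < m), |ξ'|, |ξ'₀| = O(V⁻²), and g, g₀, II, II₀ mutually comparable symmetric positive tensors, there exists C > 0 such that | |𝒜₀|²_{𝒢₀} − |𝒜|²_𝒢 | ≤ C·( |𝒜₀ − 𝒜|_{𝒢₀} + |𝒢₀ − 𝒢|_{𝒢₀} ), where |𝒜|²_𝒢 = |II|²_g + (V⁻¹V')² + ½V²|ξ'|²_g, |𝒜₀|²_{𝒢₀} = |II₀|²_{g₀} + (V₀⁻¹V₀')² + ½V₀²|ξ₀'|²_{g₀}, |𝒜−𝒜₀|²_{𝒢₀} = |II−II₀|²_{g₀} + V₀⁻⁴(VV'−V₀V₀')² + ½V₀⁻²|V²ξ'−V₀²ξ₀'|²_{g₀}, and |𝒢₀−𝒢|²_{𝒢₀} = V₀⁻⁴(V²−V₀²)² + |g−g₀|²_{g₀}. -/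

import Mathlib

/-- `g`-norm squared of a 2-tensor: `|T|²_g = g^{ik} g^{jl} T_{ij} T_{kl}`. -/
noncomputable def tensorNormSq {ι : Type*} [Fintype ι] [DecidableEq ι]
    (g T : Matrix ι ι ℝ) : ℝ :=
  ∑ i, ∑ j, ∑ k, ∑ l, g⁻¹ i k * g⁻¹ j l * T i j * T k l

/-- `g`-norm squared of a 1-form: `|ξ|²_g = g^{ij} ξ_i ξ_j`. -/
noncomputable def covectorNormSq {ι : Type*} [Fintype ι] [DecidableEq ι]
    (g : Matrix ι ι ℝ) (ξ : ι → ℝ) : ℝ :=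
  ∑ i, ∑ j, g⁻¹ i j * ξ i * ξ j

open scoped MatrixOrder in
lemma aux_factor {ι : Type*} [Fintype ι] [DecidableEq ι] {h : Matrix ι ι ℝ} (hh : h.PosSemidef) :
    ∃ B : Matrix ι ι ℝ, ∀ j l, h j l = ∑ a, B a j * B a l := by
  obtain ⟨B, hB⟩ := CStarAlgebra.nonneg_iff_eq_star_mul_self.mp hh.nonneg
  refine ⟨B, fun j l => ?_⟩
  rw [hB, Matrix.mul_apply]
  simp [Matrix.star_apply]

lemma aux_quad {ι : Type*} [Fintype ι] [DecidableEq ι] {g : Matrix ι ι ℝ} (hg : g.PosSemidef)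
    (x : ι → ℝ) : 0 ≤ x ⬝ᵥ (g.mulVec x) := by
  simpa using hg.dotProduct_mulVec_nonneg x

lemma aux_dot_self {ι : Type*} [Fintype ι] (x : ι → ℝ) : x ⬝ᵥ x = ∑ i, x i ^ 2 := by
  simp [dotProduct, sq]

lemma aux_cov_eq {ι : Type*} [Fintype ι] [DecidableEq ι] (g : Matrix ι ι ℝ) (x : ι → ℝ) :
    covectorNormSq g x = x ⬝ᵥ (g⁻¹.mulVec x) := by
  simp only [covectorNormSq, dotProduct, Matrix.mulVec, Finset.mul_sum]
  refine Finset.sum_congr rfl fun i _ => Finset.sum_congr rfl fun j _ => by ring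

lemma aux_symm_dot {ι : Type*} [Fintype ι] {g : Matrix ι ι ℝ} (hs : g.IsSymm) (x y : ι → ℝ) :
    x ⬝ᵥ (g.mulVec y) = y ⬝ᵥ (g.mulVec x) := by
  rw [Matrix.dotProduct_mulVec, ← Matrix.mulVec_transpose, hs.eq, dotProduct_comm]

/-- `g ≤ M` implies `g⁻¹ ≥ M⁻¹`. -/
lemma aux_cov_lower {ι : Type*} [Fintype ι] [DecidableEq ι] {g : Matrix ι ι ℝ} {M : ℝ}
    (hM : 0 < M) (hs : g.IsSymm) (hg : g.PosDef)
    (hgM : (M • (1 : Matrix ι ι ℝ) - g).PosSemidef) (v : ι → ℝ) :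
    ∑ i, v i ^ 2 ≤ M * covectorNormSq g v := by
  rw [aux_cov_eq, ← aux_dot_self]
  set w := g⁻¹.mulVec v with hw
  have hgw : g.mulVec w = v := by
    rw [hw, Matrix.mulVec_mulVec, Matrix.mul_nonsing_inv _ ((Matrix.isUnit_iff_isUnit_det g).mp hg.isUnit),
      Matrix.one_mulVec]
  have h1 := aux_quad hg.posSemidef (v - M • w)
  have h2 := aux_quad hgM v
  have h3 : w ⬝ᵥ (g.mulVec v) = v ⬝ᵥ v := by rw [aux_symm_dot hs, hgw]
  rw [Matrix.mulVec_sub, Matrix.mulVec_smul, hgw, sub_dotProduct, dotProduct_sub, dotProduct_sub] at h1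
  simp only [smul_dotProduct, dotProduct_smul, smul_eq_mul, h3] at h1
  rw [Matrix.sub_mulVec, Matrix.smul_mulVec, Matrix.one_mulVec, dotProduct_sub, dotProduct_smul,
    smul_eq_mul] at h2
  rw [dotProduct_comm w v] at h1
  have : 0 ≤ M * (M * (v ⬝ᵥ w) - v ⬝ᵥ v) := by nlinarith
  have := nonneg_of_mul_nonneg_right this hM
  linarith

lemma aux_tensor_lower {ι : Type*} [Fintype ι] [DecidableEq ι] {g : Matrix ι ι ℝ} {M : ℝ}
    (hM : 0 < M) (hs : g.IsSymm) (hg : g.PosDef)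
    (hgM : (M • (1 : Matrix ι ι ℝ) - g).PosSemidef) (T : Matrix ι ι ℝ) :
    ∑ i, ∑ j, T i j ^ 2 ≤ M ^ 2 * tensorNormSq g T := by
  obtain ⟨B, hB⟩ := aux_factor hg.inv.posSemidef
  have e1 : tensorNormSq g T = ∑ a, covectorNormSq g (fun i => ∑ j, B a j * T i j) := by
    simp only [tensorNormSq, covectorNormSq]
    conv_rhs => rw [Finset.sum_comm]
    refine Finset.sum_congr rfl fun i _ => ?_
    rw [Finset.sum_comm]
    conv_rhs => rw [Finset.sum_comm]
    refine Finset.sum_congr rfl fun k _ => ?_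
    have h1 : ∀ a, g⁻¹ i k * (∑ j, B a j * T i j) * (∑ j, B a j * T k j)
        = ∑ j, ∑ l, g⁻¹ i k * (B a j * B a l) * T i j * T k l := by
      intro a
      rw [mul_assoc, Finset.sum_mul_sum, Finset.mul_sum]
      refine Finset.sum_congr rfl fun j _ => ?_
      rw [Finset.mul_sum]
      exact Finset.sum_congr rfl fun l _ => by ring
    rw [Finset.sum_congr rfl fun a _ => h1 a]
    conv_rhs => rw [Finset.sum_comm]
    refine Finset.sum_congr rfl fun j _ => ?_
    conv_rhs => rw [Finset.sum_comm]
    refine Finset.sum_congr rfl fun l _ => ?_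
    rw [hB j l, Finset.mul_sum, Finset.sum_mul, Finset.sum_mul]
  have e2 : ∀ i, covectorNormSq g (fun j => T i j) = ∑ a, (∑ j, B a j * T i j) ^ 2 := by
    intro i
    simp only [covectorNormSq, hB, sq, Finset.sum_mul]
    rw [Finset.sum_comm_cycle]
    refine Finset.sum_congr rfl fun a _ => Finset.sum_congr rfl fun j _ => ?_
    rw [Finset.mul_sum]
    exact Finset.sum_congr rfl fun l _ => by ring
  calc ∑ i, ∑ j, T i j ^ 2 ≤ ∑ i, M * covectorNormSq g (fun j => T i j) :=
        Finset.sum_le_sum fun i _ => aux_cov_lower hM hs hg hgM _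
    _ = M * ∑ a, ∑ i, (∑ j, B a j * T i j) ^ 2 := by
        rw [← Finset.mul_sum, Finset.sum_comm]; simp_rw [e2]
    _ ≤ M * ∑ a, M * covectorNormSq g (fun i => ∑ j, B a j * T i j) := by
        gcongr with a
        exact aux_cov_lower hM hs hg hgM _
    _ = M ^ 2 * tensorNormSq g T := by rw [e1, ← Finset.mul_sum]; ring

lemma aux_inv_bound {ι : Type*} [Fintype ι] [DecidableEq ι] {g : Matrix ι ι ℝ} {c : ℝ}
    (hc : 0 < c) (hg : g.PosDef) (hgc : (g - c • (1 : Matrix ι ι ℝ)).PosSemidef) (i j : ι) :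
    |g⁻¹ i j| ≤ c⁻¹ := by
  set y : ι → ℝ := g⁻¹.mulVec (Pi.single j 1) with hy
  have hyi : ∀ k, y k = g⁻¹ k j := by intro k; simp [hy]
  have hgy : g.mulVec y = Pi.single j 1 := by
    rw [hy, Matrix.mulVec_mulVec, Matrix.mul_nonsing_inv _ ((Matrix.isUnit_iff_isUnit_det g).mp hg.isUnit),
      Matrix.one_mulVec]
  have h := aux_quad hgc y
  rw [Matrix.sub_mulVec, Matrix.smul_mulVec, Matrix.one_mulVec, dotProduct_sub, dotProduct_smul,
    smul_eq_mul, hgy, aux_dot_self] at h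
  simp only [dotProduct_single, mul_one] at h
  have hk : ∀ k, y k ^ 2 ≤ ∑ i, y i ^ 2 := fun k =>
    Finset.single_le_sum (f := fun i => y i ^ 2) (fun i _ => sq_nonneg _) (Finset.mem_univ k)
  have hj : c * y j ^ 2 ≤ y j := by nlinarith [hk j]
  have hj0 : 0 ≤ y j := le_trans (by positivity) hj
  have hj1 : y j ≤ c⁻¹ := by
    by_contra hcon
    push Not at hcon
    have h1 : 1 < c * y j := by
      have := mul_lt_mul_of_pos_left hcon hc
      rwa [mul_inv_cancel₀ hc.ne'] at this
    nlinarith [inv_pos.mpr hc]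
  rw [← hyi]
  refine abs_le_of_sq_le_sq ?_ (by positivity)
  have h2 : c * y i ^ 2 ≤ c⁻¹ := by nlinarith [hk i]
  calc y i ^ 2 = c⁻¹ * (c * y i ^ 2) := by field_simp
    _ ≤ c⁻¹ * c⁻¹ := by gcongr
    _ = c⁻¹ ^ 2 := by ring

lemma aux_psd_bound {ι : Type*} [Fintype ι] [DecidableEq ι] {g : Matrix ι ι ℝ} {c : ℝ}
    (hs : g.IsSymm) (hg : g.PosSemidef) (hgc : (c • (1 : Matrix ι ι ℝ) - g).PosSemidef) (i j : ι) :
    |g i j| ≤ c := by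
  have hd : ∀ k, g k k ≤ c := by
    intro k
    have := hgc.diag_nonneg (i := k)
    simpa using this
  have hij : g j i = g i j := hs.apply i j
  have h1 := aux_quad hg (Pi.single i 1 + Pi.single j 1)
  have h2 := aux_quad hg (Pi.single i 1 - Pi.single j 1)
  simp only [Matrix.mulVec_add, Matrix.mulVec_sub, add_dotProduct, sub_dotProduct, dotProduct_add,
    dotProduct_sub, Matrix.mulVec_single_one, single_one_dotProduct, Matrix.col_apply] at h1 h2
  have := hd i
  have := hd j
  rw [abs_le]
  constructor <;> linarith

def AuxBD {Ω : Type*} (a : Ω → ℝ) : Prop := ∃ K, 0 ≤ K ∧ ∀ w, |a w| ≤ K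

def AuxSM {Ω : Type*} (D : Ω → ℝ) (a : Ω → ℝ) : Prop := ∃ K, 0 ≤ K ∧ ∀ w, |a w| ≤ K * D w

lemma AuxBD.add {Ω : Type*} {a b : Ω → ℝ} (ha : AuxBD a) (hb : AuxBD b) :
    AuxBD (fun w => a w + b w) := by
  obtain ⟨K, hK, h⟩ := ha
  obtain ⟨L, hL, h'⟩ := hb
  exact ⟨K + L, by positivity, fun w => (abs_add_le _ _).trans (add_le_add (h w) (h' w))⟩

lemma AuxBD.mul {Ω : Type*} {a b : Ω → ℝ} (ha : AuxBD a) (hb : AuxBD b) :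
    AuxBD (fun w => a w * b w) := by
  obtain ⟨K, hK, h⟩ := ha
  obtain ⟨L, hL, h'⟩ := hb
  refine ⟨K * L, by positivity, fun w => ?_⟩
  rw [abs_mul]
  exact mul_le_mul (h w) (h' w) (abs_nonneg _) hK

lemma AuxSM.add {Ω : Type*} {D a b : Ω → ℝ} (ha : AuxSM D a) (hb : AuxSM D b) :
    AuxSM D (fun w => a w + b w) := by
  obtain ⟨K, hK, h⟩ := ha
  obtain ⟨L, hL, h'⟩ := hb
  refine ⟨K + L, by positivity, fun w => (abs_add_le _ _).trans ?_⟩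
  rw [add_mul]
  exact add_le_add (h w) (h' w)

lemma AuxSM.mul {Ω : Type*} {D a b : Ω → ℝ} (ha : AuxBD a) (hb : AuxSM D b) :
    AuxSM D (fun w => a w * b w) := by
  obtain ⟨K, hK, h⟩ := ha
  obtain ⟨L, hL, h'⟩ := hb
  refine ⟨K * L, by positivity, fun w => ?_⟩
  rw [abs_mul, mul_assoc]
  exact mul_le_mul (h w) (h' w) (abs_nonneg _) hK

lemma AuxSM.sum {Ω κ : Type*} {D : Ω → ℝ} (s : Finset κ) {a : κ → Ω → ℝ}
    (ha : ∀ i, AuxSM D (a i)) : AuxSM D (fun w => ∑ i ∈ s, a i w) := by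
  classical
  induction s using Finset.induction_on with
  | empty => exact ⟨0, le_rfl, by simp⟩
  | insert i s hi ih =>
    simp only [Finset.sum_insert hi]
    exact (ha i).add ih

lemma AuxBD.sum {Ω κ : Type*} (s : Finset κ) {a : κ → Ω → ℝ}
    (ha : ∀ i, AuxBD (a i)) : AuxBD (fun w => ∑ i ∈ s, a i w) := by
  classical
  induction s using Finset.induction_on with
  | empty => exact ⟨0, le_rfl, by simp⟩
  | insert i s hi ih =>
    simp only [Finset.sum_insert hi]
    exact (ha i).add ih

/-- bounded pair with difference controlled by `D`. -/
def AuxQ {Ω : Type*} (D a b : Ω → ℝ) : Prop := AuxBD a ∧ AuxBD b ∧ AuxSM D (fun w => a w - b w)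

lemma AuxQ.add {Ω : Type*} {D a a' b b' : Ω → ℝ} (ha : AuxQ D a a') (hb : AuxQ D b b') :
    AuxQ D (fun w => a w + b w) (fun w => a' w + b' w) := by
  refine ⟨ha.1.add hb.1, ha.2.1.add hb.2.1, ?_⟩
  have := ha.2.2.add hb.2.2
  convert this using 2
  ring

lemma AuxQ.mul {Ω : Type*} {D a a' b b' : Ω → ℝ} (ha : AuxQ D a a') (hb : AuxQ D b b') :
    AuxQ D (fun w => a w * b w) (fun w => a' w * b' w) := by
  refine ⟨ha.1.mul hb.1, ha.2.1.mul hb.2.1, ?_⟩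
  have := (AuxSM.mul ha.1 hb.2.2).add (AuxSM.mul hb.2.1 ha.2.2)
  convert this using 2
  ring

lemma AuxQ.sum {Ω κ : Type*} {D : Ω → ℝ} (s : Finset κ) {a b : κ → Ω → ℝ}
    (ha : ∀ i, AuxQ D (a i) (b i)) :
    AuxQ D (fun w => ∑ i ∈ s, a i w) (fun w => ∑ i ∈ s, b i w) := by
  refine ⟨AuxBD.sum s fun i => (ha i).1, AuxBD.sum s fun i => (ha i).2.1, ?_⟩
  have := AuxSM.sum s fun i => (ha i).2.2
  simpa only [Finset.sum_sub_distrib] using this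

lemma AuxBD.inv {Ω : Type*} {a : Ω → ℝ} {c : ℝ} (hc : 0 < c) (h : ∀ w, c ≤ a w) :
    AuxBD (fun w => (a w)⁻¹) := by
  refine ⟨c⁻¹, by positivity, fun w => ?_⟩
  have h1 : 0 < a w := hc.trans_le (h w)
  rw [abs_of_pos (inv_pos.mpr h1)]
  exact inv_anti₀ hc (h w)

lemma AuxQ.inv {Ω : Type*} {D a b : Ω → ℝ} {c : ℝ} (hc : 0 < c) (h : ∀ w, c ≤ a w)
    (h' : ∀ w, c ≤ b w) (ha : AuxQ D a b) :
    AuxQ D (fun w => (a w)⁻¹) (fun w => (b w)⁻¹) := by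
  have h1 := AuxBD.inv hc h
  have h2 := AuxBD.inv hc h'
  refine ⟨h1, h2, ?_⟩
  obtain ⟨K, hK, hh⟩ := AuxSM.mul (h1.mul h2) ha.2.2
  refine ⟨K, hK, fun w => ?_⟩
  refine le_trans (le_of_eq ?_) (hh w)
  have := (hc.trans_le (h w)).ne'
  have := (hc.trans_le (h' w)).ne'
  rw [← abs_neg]
  congr 1
  field_simp
  ring

lemma AuxSM.of_sq {Ω : Type*} {D a : Ω → ℝ} {K : ℝ} (hK : 0 ≤ K) (hD : ∀ w, 0 ≤ D w)
    (h : ∀ w, a w ^ 2 ≤ K * D w ^ 2) : AuxSM D a := by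
  refine ⟨√K, by positivity, fun w => ?_⟩
  refine abs_le_of_sq_le_sq ?_ (mul_nonneg (by positivity) (hD w))
  rw [mul_pow, Real.sq_sqrt hK]
  exact h w

/-- The admissible data. -/
structure AuxData (ι : Type*) [Fintype ι] [DecidableEq ι] (m M : ℝ) where
  V : ℝ
  V' : ℝ
  V₀ : ℝ
  V₀' : ℝ
  ξ : ι → ℝ
  ξ₀ : ι → ℝ
  g : Matrix ι ι ℝ
  g₀ : Matrix ι ι ℝ
  II : Matrix ι ι ℝ
  II₀ : Matrix ι ι ℝ
  hV : V ∈ Set.Icc m M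
  hV' : V' ∈ Set.Icc m M
  hV₀ : V₀ ∈ Set.Icc m M
  hV₀' : V₀' ∈ Set.Icc m M
  hξ : ∑ i, ξ i ^ 2 ≤ (M / V ^ 2) ^ 2
  hξ₀ : ∑ i, ξ₀ i ^ 2 ≤ (M / V₀ ^ 2) ^ 2
  sg₀ : g₀.IsSymm
  sII : II.IsSymm
  sII₀ : II₀.IsSymm
  pg : g.PosDef
  pg₀ : g₀.PosDef
  h1 : (g₀ - m • (1 : Matrix ι ι ℝ)).PosSemidef
  h2 : (M • (1 : Matrix ι ι ℝ) - g₀).PosSemidef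
  h3 : (g - m • g₀).PosSemidef
  h5 : (II - m • g₀).PosSemidef
  h6 : (M • g₀ - II).PosSemidef
  h7 : (II₀ - m • g₀).PosSemidef
  h8 : (M • g₀ - II₀).PosSemidef

noncomputable def AuxData.X {ι : Type*} [Fintype ι] [DecidableEq ι] {m M : ℝ}
    (w : AuxData ι m M) : ℝ :=
  tensorNormSq w.g₀ (w.II - w.II₀) + w.V₀⁻¹ ^ 4 * (w.V * w.V' - w.V₀ * w.V₀') ^ 2
    + (1 / 2) * w.V₀⁻¹ ^ 2 * covectorNormSq w.g₀ (fun i => w.V ^ 2 * w.ξ i - w.V₀ ^ 2 * w.ξ₀ i)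

noncomputable def AuxData.Y {ι : Type*} [Fintype ι] [DecidableEq ι] {m M : ℝ}
    (w : AuxData ι m M) : ℝ :=
  w.V₀⁻¹ ^ 4 * (w.V ^ 2 - w.V₀ ^ 2) ^ 2 + tensorNormSq w.g₀ (w.g - w.g₀)

noncomputable def AuxData.D {ι : Type*} [Fintype ι] [DecidableEq ι] {m M : ℝ}
    (w : AuxData ι m M) : ℝ := Real.sqrt w.X + Real.sqrt w.Y

section
variable {ι : Type*} [Fintype ι] [DecidableEq ι] {m M : ℝ}

lemma AuxData.D_nonneg (w : AuxData ι m M) : 0 ≤ w.D := by unfold AuxData.D; positivity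

lemma AuxData.X_le (w : AuxData ι m M) : w.X ≤ w.D ^ 2 := by
  rcases le_total 0 w.X with h | h
  · have h1 := Real.sq_sqrt h
    have h2 := Real.sqrt_nonneg w.X
    have h3 := Real.sqrt_nonneg w.Y
    unfold AuxData.D
    nlinarith
  · exact h.trans (sq_nonneg _)

lemma AuxData.Y_le (w : AuxData ι m M) : w.Y ≤ w.D ^ 2 := by
  rcases le_total 0 w.Y with h | h
  · have h1 := Real.sq_sqrt h
    have h2 := Real.sqrt_nonneg w.X
    have h3 := Real.sqrt_nonneg w.Y
    unfold AuxData.D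
    nlinarith
  · exact h.trans (sq_nonneg _)

lemma AuxData.cov_nonneg (hM : 0 < M) (w : AuxData ι m M) (v : ι → ℝ) :
    0 ≤ covectorNormSq w.g₀ v := by
  have h := aux_cov_lower hM w.sg₀ w.pg₀ w.h2 v
  have : 0 ≤ ∑ i, v i ^ 2 := Finset.sum_nonneg fun i _ => sq_nonneg _
  exact nonneg_of_mul_nonneg_right (this.trans h) hM

lemma AuxData.ten_nonneg (hM : 0 < M) (w : AuxData ι m M) (T : Matrix ι ι ℝ) :
    0 ≤ tensorNormSq w.g₀ T := by
  have h := aux_tensor_lower hM w.sg₀ w.pg₀ w.h2 T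
  have : 0 ≤ ∑ i, ∑ j, T i j ^ 2 :=
    Finset.sum_nonneg fun i _ => Finset.sum_nonneg fun j _ => sq_nonneg _
  exact nonneg_of_mul_nonneg_right (this.trans h) (by positivity)

lemma AuxData.ten_entry (hM : 0 < M) (w : AuxData ι m M) (T : Matrix ι ι ℝ) (i j : ι) :
    T i j ^ 2 ≤ M ^ 2 * tensorNormSq w.g₀ T := by
  refine le_trans ?_ (aux_tensor_lower hM w.sg₀ w.pg₀ w.h2 T)
  refine le_trans ?_ (Finset.single_le_sum (f := fun i => ∑ j, T i j ^ 2)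
    (fun i _ => Finset.sum_nonneg fun j _ => sq_nonneg _) (Finset.mem_univ i))
  exact Finset.single_le_sum (f := fun j => T i j ^ 2) (fun i _ => sq_nonneg _) (Finset.mem_univ j)

lemma AuxData.cov_entry (hM : 0 < M) (w : AuxData ι m M) (v : ι → ℝ) (i : ι) :
    v i ^ 2 ≤ M * covectorNormSq w.g₀ v := by
  refine le_trans ?_ (aux_cov_lower hM w.sg₀ w.pg₀ w.h2 v)
  exact Finset.single_le_sum (f := fun j => v j ^ 2) (fun i _ => sq_nonneg _) (Finset.mem_univ i)

lemma aux_bd_II (hm : 0 < m) (hM : 0 < M) {g₀ II : Matrix ι ι ℝ} (sII : II.IsSymm)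
    (pg₀ : g₀.PosDef) (h2 : (M • (1 : Matrix ι ι ℝ) - g₀).PosSemidef)
    (h5 : (II - m • g₀).PosSemidef) (h6 : (M • g₀ - II).PosSemidef) (i j : ι) :
    |II i j| ≤ M ^ 2 := by
  refine aux_psd_bound sII ?_ ?_ i j
  · have := h5.add (pg₀.posSemidef.smul hm.le)
    simpa using this
  · have := h6.add (h2.smul hM.le)
    convert this using 1
    rw [smul_sub, smul_smul, sq]
    abel

lemma aux_xi_bd (hm : 0 < m) {V : ℝ} (hV : V ∈ Set.Icc m M) {ξ : ι → ℝ}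
    (hξ : ∑ i, ξ i ^ 2 ≤ (M / V ^ 2) ^ 2) (i : ι) : |V ^ 2 * ξ i| ≤ M := by
  have hV0 : 0 < V := hm.trans_le hV.1
  have hM : 0 < M := hV0.trans_le hV.2
  have h := (Finset.single_le_sum (f := fun j => ξ j ^ 2) (fun i _ => sq_nonneg _)
    (Finset.mem_univ i)).trans hξ
  have h' : |ξ i| ≤ M / V ^ 2 := abs_le_of_sq_le_sq h (by positivity)
  rw [abs_mul, abs_of_pos (by positivity : 0 < V ^ 2)]
  rw [le_div_iff₀ (by positivity)] at h'
  linarith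

lemma aux_V4 {V : ℝ} (hm : 0 < m) (hV : V ∈ Set.Icc m M) (t : ℝ) (k : ℕ) (ht : 0 ≤ t) :
    t ≤ M ^ k * (V⁻¹ ^ k * t) := by
  have hV0 : 0 < V := hm.trans_le hV.1
  have : 1 ≤ M ^ k * V⁻¹ ^ k := by
    rw [← mul_pow]
    apply one_le_pow₀
    rw [← div_eq_mul_inv, one_le_div hV0]
    exact hV.2
  nlinarith

lemma AuxData.X_parts (hm : 0 < m) (hM : 0 < M) (w : AuxData ι m M) :
    tensorNormSq w.g₀ (w.II - w.II₀) ≤ w.D ^ 2 ∧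
    w.V₀⁻¹ ^ 4 * (w.V * w.V' - w.V₀ * w.V₀') ^ 2 ≤ w.D ^ 2 ∧
    (1 / 2) * w.V₀⁻¹ ^ 2 * covectorNormSq w.g₀ (fun i => w.V ^ 2 * w.ξ i - w.V₀ ^ 2 * w.ξ₀ i)
      ≤ w.D ^ 2 ∧
    w.V₀⁻¹ ^ 4 * (w.V ^ 2 - w.V₀ ^ 2) ^ 2 ≤ w.D ^ 2 ∧
    tensorNormSq w.g₀ (w.g - w.g₀) ≤ w.D ^ 2 := by
  have hX := w.X_le
  have hY := w.Y_le
  have hV0 : 0 < w.V₀ := hm.trans_le w.hV₀.1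
  have a1 := w.ten_nonneg hM (w.II - w.II₀)
  have a2 := w.ten_nonneg hM (w.g - w.g₀)
  have a3 : 0 ≤ w.V₀⁻¹ ^ 4 * (w.V * w.V' - w.V₀ * w.V₀') ^ 2 := by positivity
  have a4 : 0 ≤ w.V₀⁻¹ ^ 4 * (w.V ^ 2 - w.V₀ ^ 2) ^ 2 := by positivity
  have a5 : 0 ≤ (1 / 2) * w.V₀⁻¹ ^ 2 *
      covectorNormSq w.g₀ (fun i => w.V ^ 2 * w.ξ i - w.V₀ ^ 2 * w.ξ₀ i) :=
    mul_nonneg (by positivity) (w.cov_nonneg hM _)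
  unfold AuxData.X at hX
  unfold AuxData.Y at hY
  refine ⟨?_, ?_, ?_, ?_, ?_⟩ <;> linarith

lemma AuxData.Q_II (hm : 0 < m) (hM : 0 < M) (i j : ι) :
    AuxQ (fun w : AuxData ι m M => w.D) (fun w => w.II i j) (fun w => w.II₀ i j) := by
  refine ⟨⟨M ^ 2, by positivity, fun w => aux_bd_II hm hM w.sII w.pg₀ w.h2 w.h5 w.h6 i j⟩,
    ⟨M ^ 2, by positivity, fun w => aux_bd_II hm hM w.sII₀ w.pg₀ w.h2 w.h7 w.h8 i j⟩, ?_⟩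
  refine AuxSM.of_sq (K := M ^ 2) (by positivity) (fun w => w.D_nonneg) fun w => ?_
  refine (w.ten_entry hM (w.II - w.II₀) i j).trans ?_
  gcongr
  exact (w.X_parts hm hM).1

lemma AuxData.SM_g (hm : 0 < m) (hM : 0 < M) (i j : ι) :
    AuxSM (fun w : AuxData ι m M => w.D) (fun w => (w.g - w.g₀) i j) := by
  refine AuxSM.of_sq (K := M ^ 2) (by positivity) (fun w => w.D_nonneg) fun w => ?_
  refine (w.ten_entry hM (w.g - w.g₀) i j).trans ?_
  gcongr
  exact (w.X_parts hm hM).2.2.2.2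

lemma AuxData.Q_inv (hm : 0 < m) (hM : 0 < M) (i j : ι) :
    AuxQ (fun w : AuxData ι m M => w.D) (fun w => w.g⁻¹ i j) (fun w => w.g₀⁻¹ i j) := by
  have b1 : ∀ i j, AuxBD (fun w : AuxData ι m M => w.g⁻¹ i j) := by
    intro i j
    refine ⟨(m ^ 2)⁻¹, by positivity, fun w => aux_inv_bound (by positivity) w.pg ?_ i j⟩
    have := w.h3.add (w.h1.smul hm.le)
    convert this using 1
    rw [smul_sub, smul_smul, sq]
    abel
  have b2 : ∀ i j, AuxBD (fun w : AuxData ι m M => w.g₀⁻¹ i j) := by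
    intro i j
    exact ⟨m⁻¹, by positivity, fun w => aux_inv_bound hm w.pg₀ w.h1 i j⟩
  refine ⟨b1 i j, b2 i j, ?_⟩
  have key := AuxSM.sum Finset.univ fun k => AuxSM.sum Finset.univ fun l =>
    AuxSM.mul ((b1 i k).mul (b2 l j)) (AuxData.SM_g hm hM k l)
  obtain ⟨K, hK, h⟩ := key
  refine ⟨K, hK, fun w => ?_⟩
  refine le_trans (le_of_eq ?_) (h w)
  have e : w.g₀⁻¹ - w.g⁻¹ = w.g⁻¹ * ((w.g - w.g₀) * w.g₀⁻¹) := by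
    rw [Matrix.sub_mul, Matrix.mul_sub, ← Matrix.mul_assoc,
      Matrix.mul_nonsing_inv _ ((Matrix.isUnit_iff_isUnit_det w.g₀).mp w.pg₀.isUnit),
      Matrix.nonsing_inv_mul _ ((Matrix.isUnit_iff_isUnit_det w.g).mp w.pg.isUnit),
      Matrix.one_mul, Matrix.mul_one]
  have e' := congrFun (congrFun e i) j
  rw [abs_sub_comm]
  congr 1
  refine e'.trans ?_
  rw [Matrix.mul_apply]
  refine Finset.sum_congr rfl fun k _ => ?_
  rw [Matrix.mul_apply, Finset.mul_sum]
  exact Finset.sum_congr rfl fun l _ => by ring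

lemma aux_bd_mul (hm : 0 < m) {x y : ℝ} (hx : x ∈ Set.Icc m M) (hy : y ∈ Set.Icc m M) :
    |x * y| ≤ M ^ 2 := by
  have hx0 : 0 < x := hm.trans_le hx.1
  have hy0 : 0 < y := hm.trans_le hy.1
  rw [abs_of_pos (by positivity), sq]
  exact mul_le_mul hx.2 hy.2 hy0.le (hx0.le.trans hx.2)

lemma AuxData.Q_V2 (hm : 0 < m) (hM : 0 < M) :
    AuxQ (fun w : AuxData ι m M => w.D) (fun w => w.V ^ 2) (fun w => w.V₀ ^ 2) := by
  refine ⟨⟨M ^ 2, by positivity, fun w => by simpa [sq] using aux_bd_mul hm w.hV w.hV⟩,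
    ⟨M ^ 2, by positivity, fun w => by simpa [sq] using aux_bd_mul hm w.hV₀ w.hV₀⟩, ?_⟩
  refine AuxSM.of_sq (K := M ^ 4) (by positivity) (fun w => w.D_nonneg) fun w => ?_
  refine (aux_V4 hm w.hV₀ _ 4 (sq_nonneg _)).trans ?_
  gcongr
  exact (w.X_parts hm hM).2.2.2.1

lemma AuxData.Q_VV (hm : 0 < m) (hM : 0 < M) :
    AuxQ (fun w : AuxData ι m M => w.D) (fun w => w.V * w.V') (fun w => w.V₀ * w.V₀') := by
  refine ⟨⟨M ^ 2, by positivity, fun w => aux_bd_mul hm w.hV w.hV'⟩,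
    ⟨M ^ 2, by positivity, fun w => aux_bd_mul hm w.hV₀ w.hV₀'⟩, ?_⟩
  refine AuxSM.of_sq (K := M ^ 4) (by positivity) (fun w => w.D_nonneg) fun w => ?_
  refine (aux_V4 hm w.hV₀ _ 4 (sq_nonneg _)).trans ?_
  gcongr
  exact (w.X_parts hm hM).2.1

lemma AuxData.Q_xi (hm : 0 < m) (hM : 0 < M) (i : ι) :
    AuxQ (fun w : AuxData ι m M => w.D) (fun w => w.V ^ 2 * w.ξ i)
      (fun w => w.V₀ ^ 2 * w.ξ₀ i) := by
  refine ⟨⟨M, hM.le, fun w => aux_xi_bd hm w.hV w.hξ i⟩,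
    ⟨M, hM.le, fun w => aux_xi_bd hm w.hV₀ w.hξ₀ i⟩, ?_⟩
  refine AuxSM.of_sq (K := M * (M ^ 2 * 2)) (by positivity) (fun w => w.D_nonneg) fun w => ?_
  refine (w.cov_entry hM (fun i => w.V ^ 2 * w.ξ i - w.V₀ ^ 2 * w.ξ₀ i) i).trans ?_
  rw [mul_assoc]
  gcongr
  refine (aux_V4 hm w.hV₀ _ 2 (w.cov_nonneg hM _)).trans ?_
  rw [mul_assoc]
  refine mul_le_mul_of_nonneg_left ?_ (by positivity)
  have := (w.X_parts hm hM).2.2.1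
  linarith

lemma AuxQ.const {Ω : Type*} {D : Ω → ℝ} (c : ℝ) : AuxQ D (fun _ => c) (fun _ => c) :=
  ⟨⟨|c|, abs_nonneg c, fun _ => le_rfl⟩, ⟨|c|, abs_nonneg c, fun _ => le_rfl⟩,
    ⟨0, le_rfl, fun w => by simp⟩⟩

lemma AuxData.Q_main (hm : 0 < m) (hM : 0 < M) :
    AuxQ (fun w : AuxData ι m M => w.D)
      (fun w => tensorNormSq w.g w.II + (w.V⁻¹ * w.V') ^ 2
        + (1 / 2) * w.V ^ 2 * covectorNormSq w.g w.ξ)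
      (fun w => tensorNormSq w.g₀ w.II₀ + (w.V₀⁻¹ * w.V₀') ^ 2
        + (1 / 2) * w.V₀ ^ 2 * covectorNormSq w.g₀ w.ξ₀) := by
  have hinv : AuxQ (fun w : AuxData ι m M => w.D) (fun w => (w.V ^ 2)⁻¹)
      (fun w => (w.V₀ ^ 2)⁻¹) :=
    AuxQ.inv (c := m ^ 2) (by positivity) (fun w => pow_le_pow_left₀ hm.le w.hV.1 2)
      (fun w => pow_le_pow_left₀ hm.le w.hV₀.1 2) (AuxData.Q_V2 hm hM)
  have t1 := AuxQ.sum Finset.univ fun i => AuxQ.sum Finset.univ fun j =>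
    AuxQ.sum Finset.univ fun k => AuxQ.sum Finset.univ fun l =>
    (((AuxData.Q_inv (ι := ι) hm hM i k).mul (AuxData.Q_inv hm hM j l)).mul
      (AuxData.Q_II hm hM i j)).mul (AuxData.Q_II hm hM k l)
  have t2 := (hinv.mul (AuxData.Q_VV hm hM)).mul (hinv.mul (AuxData.Q_VV hm hM))
  have t3 := ((AuxQ.const (1 / 2)).mul hinv).mul
    (AuxQ.sum Finset.univ fun i => AuxQ.sum Finset.univ fun j =>
    ((AuxData.Q_inv (ι := ι) hm hM i j).mul (AuxData.Q_xi hm hM i)).mul (AuxData.Q_xi hm hM j))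
  have t := (t1.add t2).add t3
  have aux : ∀ (V V' : ℝ) (g : Matrix ι ι ℝ) (ξ : ι → ℝ), V ∈ Set.Icc m M →
      (V⁻¹ * V') ^ 2 = (V ^ 2)⁻¹ * (V * V') * ((V ^ 2)⁻¹ * (V * V')) ∧
      (1 / 2) * V ^ 2 * covectorNormSq g ξ = (1 / 2) * (V ^ 2)⁻¹ *
        ∑ i, ∑ j, g⁻¹ i j * (V ^ 2 * ξ i) * (V ^ 2 * ξ j) := by
    intro V V' g ξ hV
    have hV0 : V ≠ 0 := (hm.trans_le hV.1).ne'
    constructor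
    · field_simp
    · have : ∑ i, ∑ j, g⁻¹ i j * (V ^ 2 * ξ i) * (V ^ 2 * ξ j) = V ^ 4 * covectorNormSq g ξ := by
        simp only [covectorNormSq, Finset.mul_sum]
        exact Finset.sum_congr rfl fun i _ => Finset.sum_congr rfl fun j _ => by ring
      rw [this]
      field_simp
  convert t using 2 with w w
  · rw [(aux w.V w.V' w.g w.ξ w.hV).1, (aux w.V w.V' w.g w.ξ w.hV).2]; rfl
  · rw [(aux w.V₀ w.V₀' w.g₀ w.ξ₀ w.hV₀).1, (aux w.V₀ w.V₀' w.g₀ w.ξ₀ w.hV₀).2]; rfl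

end

/-- Lemma A.1 of the paper, finite-dimensional model: under comparability of
`V, V₀, V', V₀'` (all in `[m, M]`), `|ξ'| = O(V⁻²)`, `|ξ₀'| = O(V₀⁻²)`, and mutual
comparability of the symmetric positive tensors `g, g₀, II, II₀`, one has
`| |𝒜₀|²_{𝒢₀} − |𝒜|²_𝒢 | ≤ C (|𝒜₀ − 𝒜|_{𝒢₀} + |𝒢₀ − 𝒢|_{𝒢₀})` with `C = C(m, M)`. -/
theorem stmt_18 {ι : Type*} [Fintype ι] [DecidableEq ι]
    (m M : ℝ) (hm : 0 < m) (hmM : m ≤ M) :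
    ∃ C > 0, ∀ (V V' V₀ V₀' : ℝ) (ξ ξ₀ : ι → ℝ) (g g₀ II II₀ : Matrix ι ι ℝ),
      V ∈ Set.Icc m M → V' ∈ Set.Icc m M → V₀ ∈ Set.Icc m M → V₀' ∈ Set.Icc m M →
      (∑ i, ξ i ^ 2 ≤ (M / V ^ 2) ^ 2) → (∑ i, ξ₀ i ^ 2 ≤ (M / V₀ ^ 2) ^ 2) →
      g.IsSymm → g₀.IsSymm → II.IsSymm → II₀.IsSymm →
      g.PosDef → g₀.PosDef →
      (g₀ - m • (1 : Matrix ι ι ℝ)).PosSemidef → (M • (1 : Matrix ι ι ℝ) - g₀).PosSemidef →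
      (g - m • g₀).PosSemidef → (M • g₀ - g).PosSemidef →
      (II - m • g₀).PosSemidef → (M • g₀ - II).PosSemidef →
      (II₀ - m • g₀).PosSemidef → (M • g₀ - II₀).PosSemidef →
      |(tensorNormSq g₀ II₀ + (V₀⁻¹ * V₀') ^ 2 + (1 / 2) * V₀ ^ 2 * covectorNormSq g₀ ξ₀)
          - (tensorNormSq g II + (V⁻¹ * V') ^ 2 + (1 / 2) * V ^ 2 * covectorNormSq g ξ)|
        ≤ C * (Real.sqrt (tensorNormSq g₀ (II - II₀)
                + V₀⁻¹ ^ 4 * (V * V' - V₀ * V₀') ^ 2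
                + (1 / 2) * V₀⁻¹ ^ 2 *
                    covectorNormSq g₀ (fun i => V ^ 2 * ξ i - V₀ ^ 2 * ξ₀ i))
            + Real.sqrt (V₀⁻¹ ^ 4 * (V ^ 2 - V₀ ^ 2) ^ 2 + tensorNormSq g₀ (g - g₀))) := by
  obtain ⟨-, -, K, hK, h⟩ := AuxData.Q_main (ι := ι) hm (hm.trans_le hmM)
  refine ⟨K + 1, by positivity, ?_⟩
  intro V V' V₀ V₀' ξ ξ₀ g g₀ II II₀ hV hV' hV₀ hV₀' hξ hξ₀ _ sg₀ sII sII₀ pg pg₀ h1 h2 h3 _ h5 h6 h7 h8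
  let w : AuxData ι m M := ⟨V, V', V₀, V₀', ξ, ξ₀, g, g₀, II, II₀, hV, hV', hV₀, hV₀', hξ, hξ₀,
    sg₀, sII, sII₀, pg, pg₀, h1, h2, h3, h5, h6, h7, h8⟩
  have hw := h w
  have hD := w.D_nonneg
  rw [abs_sub_comm]
  have : K * w.D ≤ (K + 1) * w.D := by nlinarith
  exact hw.trans this
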